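/- arXiv:2003.13778 — 2 statements merged into one kernel-verified Lean document; each statement's English description precedes it below -/
import Mathlib

section
/- Let A be an associative unital algebra over ℂ and Θ : A → A an algebra automorphism with Θ ∘ Θ = id. Let P ∈ A be a nonzero idempotent with Θ(P) = P, let Q ∈ A be an idempotent, and write Q₊ = (Q + Θ(Q))/2, Q₋ = (Q − Θ(Q))/2. Suppose there is a scalar c ∈ ℂ with c ≠ 1/2 and c ≠ 1 such that Q₊ = c·P and Q₋² = (c − c²)·P. Then Q₋ = 0, Q = c·P, and in fact c = 0, so Q = 0. -/
/-- Let `A` be a unital ℂ-algebra with an involutive algebra automorphism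
`Θ`, `P` a nonzero `Θ`-invariant idempotent and `Q` an idempotent with even part
`Q₊ = (Q + Θ Q)/2` and odd part `Q₋ = (Q - Θ Q)/2`. If `Q₊ = c • P` and `Q₋² = (c - c²) • P`
for a scalar `c ≠ 1/2`, `c ≠ 1`, then `Q₋ = 0`, `Q = c • P`, and in fact `c = 0`, so `Q = 0`. -/
theorem idempotent_with_scalar_even_part_vanishes {A : Type*} [Ring A] [Algebra ℂ A]
    (Θ : A ≃ₐ[ℂ] A) (hΘ : ∀ a : A, Θ (Θ a) = a)
    (P : A) (hP0 : P ≠ 0) (hPidem : P * P = P) (hPΘ : Θ P = P)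
    (Q : A) (hQ : Q * Q = Q)
    (c : ℂ) (hchalf : c ≠ 1 / 2) (hc1 : c ≠ 1)
    (hplus : (1 / 2 : ℂ) • (Q + Θ Q) = c • P)
    (hminus : ((1 / 2 : ℂ) • (Q - Θ Q)) ^ 2 = (c - c ^ 2) • P) :
    (1 / 2 : ℂ) • (Q - Θ Q) = 0 ∧ Q = c • P ∧ c = 0 ∧ Q = 0 := by
  have hQX : Q = c • P + (1 / 2 : ℂ) • (Q - Θ Q) := by
    rw [← hplus]; module
  generalize (1 / 2 : ℂ) • (Q - Θ Q) = X at hQX hminus ⊢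
  rw [pow_two] at hminus
  have key : c • (P * X + X * P) = X := by
    have h := hQ
    rw [hQX] at h
    simp only [mul_add, add_mul, smul_mul_assoc, mul_smul_comm, hPidem, hminus] at h
    have h2 : c • (P * X + X * P) + c • P = X + c • P := by
      rw [add_comm X, ← h]; module
    exact add_right_cancel h2
  have hc0 : c = 0 := by
    by_contra hc
    have hd : c - c ^ 2 ≠ 0 := by
      have : c - c ^ 2 = c * (1 - c) := by ring
      rw [this]
      exact mul_ne_zero hc (sub_ne_zero.mpr (Ne.symm hc1))
    have hcomm : P * X = X * P := by
      have h : (X * X) * X = X * (X * X) := mul_assoc _ _ _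
      rw [hminus, smul_mul_assoc, mul_smul_comm] at h
      exact smul_right_injective A hd h
    have hPX : P * X = 0 := by
      have h := congrArg (fun y => P * y) key
      simp only [← hcomm, mul_smul_comm, mul_add, ← mul_assoc, hPidem] at h
      have h3 : (2 * c - 1) • (P * X) = 0 := by
        have : (2 * c - 1) • (P * X) = c • (P * X + P * X) - P * X := by module
        rw [this, h, sub_self]
      refine (smul_eq_zero.mp h3).resolve_left fun h4 => hchalf ?_
      linear_combination h4 / 2
    have hX : X = 0 := by
      rw [← key, ← hcomm, hPX]; simp
    rw [hX, mul_zero] at hminus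
    exact (smul_eq_zero.mp hminus.symm).elim hd hP0
  have hX : X = 0 := by rw [← key, hc0, zero_smul]
  refine ⟨hX, ?_, hc0, ?_⟩
  · rw [hQX, hX, add_zero]
  · rw [hQX, hX, hc0]; simp
end

section
/- Let A be a unital complex *-algebra, and let c : ℤ → A satisfy the canonical anticommutation relations: c_i c_j + c_j c_i = 0, c_i* c_j* + c_j* c_i* = 0, and c_i* c_j + c_j c_i* = δ_{ij}·1 for all i, j ∈ ℤ. Let T ∈ A satisfy T = T*, T² = 1, T c_j T = −c_j for all j < 0, and T c_j T = c_j for all j ≥ 0. Define σ_z^{(l)} = 2 c_l* c_l − 1 for l ∈ ℤ; S_j = T·∏_{k=0}^{j−1} σ_z^{(k)} for j ≥ 1, S_0 = T, and S_j = T·∏_{k=j}^{−1} σ_z^{(k)} for j < 0; and σ_x^{(l)} = S_l (c_l* + c_l), σ_y^{(l)} = i S_l (c_l − c_l*). Then for every l ∈ ℤ the elements σ_x^{(l)}, σ_y^{(l)}, σ_z^{(l)} are self-adjoint unitaries satisfying σ_x^{(l)} σ_y^{(l)} = i σ_z^{(l)} and σ_x^{(l)} σ_y^{(l)} + σ_y^{(l)}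 σ_x^{(l)} = 0, and for all l ≠ k and all α, β ∈ {x, y, z} one has σ_α^{(l)} σ_β^{(k)} = σ_β^{(k)} σ_α^{(l)} (the Jordan–Wigner transformed operators obey the Pauli-spin relations). -/
theorem jw_two_cancel {A : Type*} [Ring A] [Algebra ℂ A] (x : A) (h : x + x = 0) : x = 0 := by
  have h2 : (2 : ℂ) • x = 0 := by rw [two_smul]; exact h
  have h3 : (2 : ℂ)⁻¹ • (2 : ℂ) • x = 0 := by rw [h2, smul_zero]
  rwa [smul_smul, inv_mul_cancel₀ two_ne_zero, one_smul] at h3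

theorem jw_z_comm {A : Type*} [Ring A] (d c e : A) (h1 : c * e + e * c = 0)
    (h2 : d * e + e * d = 0) : (2 * (d * c) - 1) * e = e * (2 * (d * c) - 1) := by
  have h1' : c * e = -(e * c) := eq_neg_of_add_eq_zero_left h1
  have h2' : d * e = -(e * d) := eq_neg_of_add_eq_zero_left h2
  have : d * c * e = e * (d * c) := by
    rw [mul_assoc, h1', mul_neg, ← mul_assoc, h2', neg_mul, neg_neg, mul_assoc]
  rw [two_mul, sub_mul, mul_sub, add_mul, mul_add, this, one_mul, mul_one]

theorem jw_z_list {A : Type*} [Ring A] (z c : ℤ → A)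
    (h1 : ∀ n m, n ≠ m → z n * c m = c m * z n) (h2 : ∀ n, z n * c n = -(c n * z n))
    (L : List ℤ) (hL : L.Nodup) (m : ℤ) :
    (L.map z).prod * c m = if m ∈ L then -(c m * (L.map z).prod) else c m * (L.map z).prod := by
  induction L with
  | nil => simp
  | cons n L ih =>
    rw [List.nodup_cons] at hL
    have ih := ih hL.2
    rw [List.map_cons, List.prod_cons, mul_assoc, ih]
    by_cases hm : m = n
    · subst hm
      rw [if_neg hL.1, if_pos (by simp), ← mul_assoc, h2, neg_mul, mul_assoc]
    · have := h1 n m (Ne.symm hm)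
      by_cases hmL : m ∈ L
      · rw [if_pos hmL, if_pos (by simp [hmL]), mul_neg, ← mul_assoc, this, mul_assoc]
      · rw [if_neg hmL, if_neg (by simp [hmL, hm]), ← mul_assoc, this, mul_assoc]

theorem jw_list_comm {A : Type*} [Ring A] (z : ℤ → A) (x : A)
    (h : ∀ n, z n * x = x * z n) (L : List ℤ) :
    (L.map z).prod * x = x * (L.map z).prod := by
  induction L with
  | nil => simp
  | cons n L ih => rw [List.map_cons, List.prod_cons, mul_assoc, ih, ← mul_assoc, h, mul_assoc]

theorem jw_list_sq {A : Type*} [Ring A] (z : ℤ → A)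
    (hz : ∀ n m, z n * z m = z m * z n) (h : ∀ n, z n * z n = 1) (L : List ℤ) :
    (L.map z).prod * (L.map z).prod = 1 := by
  induction L with
  | nil => simp
  | cons n L ih =>
    have := jw_list_comm z (z n) (fun m => hz m n) L
    rw [List.map_cons, List.prod_cons]
    calc _ = z n * ((L.map z).prod * z n) * (L.map z).prod := by simp only [mul_assoc]
      _ = (z n * z n) * ((L.map z).prod * (L.map z).prod) := by rw [this]; simp only [mul_assoc]
      _ = 1 := by rw [ih, h, mul_one]

theorem jw_list_star {A : Type*} [Ring A] [StarRing A] (z : ℤ → A)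
    (hz : ∀ n m, z n * z m = z m * z n) (h : ∀ n, star (z n) = z n) (L : List ℤ) :
    star (L.map z).prod = (L.map z).prod := by
  induction L with
  | nil => simp
  | cons n L ih =>
    rw [List.map_cons, List.prod_cons, star_mul, ih, h, jw_list_comm z (z n) (fun m => hz m n) L]

/-- (Jordan–Wigner transformation.) Let `c : ℤ → A` satisfy the canonical
anticommutation relations in a unital complex *-algebra `A`, and let `T` be a self-adjoint
unitary with `T c_j T = -c_j` for `j < 0` and `T c_j T = c_j` for `j ≥ 0`. Define
`σ_z^{(l)} = 2 c_l* c_l - 1`, the strings `S_j = T·∏_{k=0}^{j-1} σ_z^{(k)}` (`j ≥ 1`),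
`S_0 = T`, `S_j = T·∏_{k=j}^{-1} σ_z^{(k)}` (`j < 0`), and
`σ_x^{(l)} = S_l (c_l* + c_l)`, `σ_y^{(l)} = i S_l (c_l - c_l*)`. Then each
`σ_α^{(l)}` is a self-adjoint unitary, `σ_x^{(l)} σ_y^{(l)} = i σ_z^{(l)}`,
`σ_x^{(l)}` and `σ_y^{(l)}` anticommute, and operators at distinct sites commute. -/
theorem jordan_wigner_pauli_relations {A : Type*} [Ring A] [Algebra ℂ A] [StarRing A]
    [StarModule ℂ A]
    (c : ℤ → A)
    (hcc : ∀ i j : ℤ, c i * c j + c j * c i = 0)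
    (hcstar : ∀ i j : ℤ, star (c i) * star (c j) + star (c j) * star (c i) = 0)
    (hcar : ∀ i j : ℤ, star (c i) * c j + c j * star (c i) = if i = j then (1 : A) else 0)
    (T : A) (hTstar : star T = T) (hT2 : T ^ 2 = 1)
    (hTneg : ∀ j : ℤ, j < 0 → T * c j * T = -c j)
    (hTpos : ∀ j : ℤ, 0 ≤ j → T * c j * T = c j)
    (σz σx σy S : ℤ → A)
    (hσz : ∀ l : ℤ, σz l = 2 * (star (c l) * c l) - 1)
    (hSpos : ∀ j : ℤ, 1 ≤ j →
      S j = T * ((List.range j.toNat).map fun k => σz (k : ℤ)).prod)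
    (hS0 : S 0 = T)
    (hSneg : ∀ j : ℤ, j < 0 →
      S j = T * ((List.range (-j).toNat).map fun k => σz (j + (k : ℤ))).prod)
    (hσx : ∀ l : ℤ, σx l = S l * (star (c l) + c l))
    (hσy : ∀ l : ℤ, σy l = Complex.I • (S l * (c l - star (c l)))) :
    (∀ l : ℤ,
        star (σx l) = σx l ∧ (σx l) ^ 2 = 1 ∧
        star (σy l) = σy l ∧ (σy l) ^ 2 = 1 ∧
        star (σz l) = σz l ∧ (σz l) ^ 2 = 1 ∧
        σx l * σy l = Complex.I • σz l ∧
        σx l * σy l + σy l * σx l = 0) ∧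
    (∀ l k : ℤ, l ≠ k →
        ∀ a ∈ ({σx l, σy l, σz l} : Set A), ∀ b ∈ ({σx k, σy k, σz k} : Set A),
          a * b = b * a) := by
  have hc2 : ∀ n, c n * c n = 0 := fun n => jw_two_cancel _ (hcc n n)
  have hd2 : ∀ n, star (c n) * star (c n) = 0 := fun n => jw_two_cancel _ (hcstar n n)
  have hdc : ∀ n, star (c n) * c n + c n * star (c n) = 1 := fun n => by simpa using hcar n n
  have hdc' : ∀ n m, n ≠ m → star (c n) * c m + c m * star (c n) = 0 := fun n m h => by
    simpa [h] using hcar n m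
  have hcdc : ∀ n, c n * star (c n) = 1 - star (c n) * c n := fun n =>
    eq_sub_of_add_eq' (hdc n)
  have hcdc3 : ∀ n, c n * (star (c n) * c n) = c n := fun n => by
    rw [← mul_assoc, hcdc, sub_mul, mul_assoc, hc2]; simp
  have zs : ∀ n, star (σz n) = σz n := fun n => by
    rw [hσz]; simp [two_mul]
  have zc : ∀ n m, n ≠ m → σz n * c m = c m * σz n := fun n m h => by
    rw [hσz]; exact jw_z_comm _ _ _ (hcc n m) (hdc' n m h)
  have zl : ∀ n, σz n * c n = -c n := fun n => by
    rw [hσz, sub_mul, mul_assoc, mul_assoc, hc2]; simp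
  have zr : ∀ n, c n * σz n = c n := fun n => by
    rw [hσz, mul_sub, two_mul, mul_add, hcdc3]; simp
  have za : ∀ n, σz n * c n = -(c n * σz n) := fun n => by rw [zl, zr]
  have zd : ∀ n m, n ≠ m → σz n * star (c m) = star (c m) * σz n := fun n m h => by
    have := congrArg star (zc n m h)
    rw [star_mul, star_mul, zs] at this
    exact this.symm
  have zld : ∀ n, σz n * star (c n) = star (c n) := fun n => by
    have := congrArg star (zr n)
    rwa [star_mul, zs] at this
  have zrd : ∀ n, star (c n) * σz n = -star (c n) := fun n => by
    have := congrArg star (zl n)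
    rwa [star_mul, zs, star_neg] at this
  have zz1 : ∀ n, σz n * σz n = 1 := fun n => by
    conv_lhs => rw [hσz n]
    rw [← hσz n]
    nth_rewrite 2 [hσz n]
    rw [mul_sub, two_mul, mul_add, ← mul_assoc, zld, hσz, two_mul]
    simp
  have zz : ∀ n m, σz n * σz m = σz m * σz n := fun n m => by
    rcases eq_or_ne n m with rfl | h
    · rfl
    · rw [hσz m, mul_sub, sub_mul, two_mul, mul_add, add_mul, ← mul_assoc, zd n m h, mul_assoc,
        zc n m h]
      simp only [mul_assoc, one_mul, mul_one]
  have TT : T * T = 1 := by rw [← sq]; exact hT2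
  have Tc : ∀ m, T * c m = if m < 0 then -(c m * T) else c m * T := fun m => by
    have e : T * c m = (T * c m * T) * T := by rw [mul_assoc (T * c m), TT, mul_one]
    split_ifs with h
    · rw [e, hTneg m h, neg_mul]
    · rw [e, hTpos m (not_lt.mp h)]
  have Td : ∀ m, T * star (c m) = if m < 0 then -(star (c m) * T) else star (c m) * T := fun m => by
    have := congrArg star (Tc m)
    split_ifs at this ⊢ with h
    · rw [star_neg, star_mul, star_mul, hTstar] at this
      rw [this, neg_neg]
    · rw [star_mul, star_mul, hTstar] at this
      exact this.symm
  have Tz : ∀ m, σz m * T = T * σz m := fun m => by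
    have h : T * (star (c m) * c m) = star (c m) * c m * T := by
      rw [← mul_assoc, Td]
      have := Tc m
      split_ifs at this ⊢ with h
      · rw [neg_mul, mul_assoc, this, mul_neg, neg_neg, mul_assoc]
      · rw [mul_assoc, this, mul_assoc]
    rw [hσz, sub_mul, mul_sub, two_mul, mul_add, add_mul, h]; simp
  have hS : ∀ j, ∃ L : List ℤ, L.Nodup ∧ S j = T * (L.map σz).prod ∧
      ∀ m, m ∈ L ↔ (0 ≤ m ∧ m < j) ∨ (j ≤ m ∧ m < 0) := by
    intro j
    rcases lt_trichotomy j 0 with h | rfl | h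
    · refine ⟨(List.range (-j).toNat).map fun k : ℕ => j + (k : ℤ), ?_, ?_, ?_⟩
      · refine List.Nodup.map ?_ List.nodup_range
        intro a b hab
        simpa using hab
      · rw [hSneg j h, List.map_map]
        simp [Function.comp_def, List.map_eq_flatMap, List.flatMap_assoc]
      · intro m
        simp only [List.mem_map, List.mem_range]
        constructor
        · rintro ⟨k, hk, rfl⟩; omega
        · intro hm; exact ⟨(m - j).toNat, by omega, by omega⟩
    · refine ⟨[], by simp, by simp [hS0], fun m => ?_⟩
      simp only [List.not_mem_nil, false_iff]; omega
    · refine ⟨(List.range j.toNat).map fun k : ℕ => (k : ℤ), ?_, ?_, ?_⟩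
      · refine List.Nodup.map ?_ List.nodup_range
        intro a b hab
        simpa using hab
      · rw [hSpos j h, List.map_map]
        simp [Function.comp_def, List.map_eq_flatMap, List.flatMap_assoc]
      · intro m
        simp only [List.mem_map, List.mem_range]
        constructor
        · rintro ⟨k, hk, rfl⟩; omega
        · intro hm; exact ⟨m.toNat, by omega, by omega⟩
  have LT : ∀ L : List ℤ, (L.map σz).prod * T = T * (L.map σz).prod := jw_list_comm σz T Tz
  have Sz : ∀ j n, S j * σz n = σz n * S j := fun j n => by
    obtain ⟨L, -, h, -⟩ := hS j
    rw [h, mul_assoc, jw_list_comm σz (σz n) (fun m => zz m n), ← mul_assoc, ← Tz, mul_assoc]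
  have ST : ∀ j, S j * T = T * S j := fun j => by
    obtain ⟨L, -, h, -⟩ := hS j
    rw [h, mul_assoc, LT]
  have SS : ∀ j k, S j * S k = S k * S j := fun j k => by
    obtain ⟨L, -, h, -⟩ := hS j
    rw [h, mul_assoc, jw_list_comm σz (S k) (fun m => (Sz k m).symm), ← mul_assoc, ← ST, mul_assoc]
  have S1 : ∀ j, S j * S j = 1 := fun j => by
    obtain ⟨L, -, h, -⟩ := hS j
    have := ST j
    nth_rewrite 2 [h]
    rw [← mul_assoc, this, h, ← mul_assoc, TT, one_mul, jw_list_sq σz zz zz1]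
  have Ss : ∀ j, star (S j) = S j := fun j => by
    obtain ⟨L, -, h, -⟩ := hS j
    rw [h, star_mul, jw_list_star σz zz zs, hTstar, LT]
  have Sc : ∀ j m, S j * c m = if m < j then -(c m * S j) else c m * S j := fun j m => by
    obtain ⟨L, hn, h, hm⟩ := hS j
    have e := jw_z_list σz c zc za L hn m
    have t := Tc m
    have hm := hm m
    by_cases h1 : m ∈ L <;> by_cases h2 : m < 0 <;> by_cases h3 : m < j <;>
      first
      | (exfalso; simp only [h1, true_iff, false_iff] at hm; omega)
      | (simp only [h1, h2, h3, if_true, if_false] at e t ⊢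
         rw [h, mul_assoc, e]
         simp only [mul_neg, ← mul_assoc, t, neg_mul, neg_neg])
  have Sca : ∀ j m, m < j → S j * c m = -(c m * S j) := fun j m h => by rw [Sc, if_pos h]
  have Scc : ∀ j m, j ≤ m → S j * c m = c m * S j := fun j m h => by
    rw [Sc, if_neg (not_lt.mpr h)]
  have Sda : ∀ j m, m < j → S j * star (c m) = -(star (c m) * S j) := fun j m h => by
    have := congrArg star (Sca j m h)
    rw [star_neg, star_mul, star_mul, Ss] at this
    rw [this, neg_neg]
  have Sdc : ∀ j m, j ≤ m → S j * star (c m) = star (c m) * S j := fun j m h => by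
    have := congrArg star (Scc j m h)
    rw [star_mul, star_mul, Ss] at this
    exact this.symm
  -- the two Majorana-type elements at each site
  have Spc : ∀ j m, j ≤ m → S j * (star (c m) + c m) = (star (c m) + c m) * S j := fun j m h => by
    rw [mul_add, add_mul, Scc j m h, Sdc j m h]
  have Smc : ∀ j m, j ≤ m → S j * (c m - star (c m)) = (c m - star (c m)) * S j := fun j m h => by
    rw [mul_sub, sub_mul, Scc j m h, Sdc j m h]
  have Spa : ∀ j m, m < j → S j * (star (c m) + c m) = -((star (c m) + c m) * S j) := fun j m h => by
    rw [mul_add, add_mul, Sca j m h, Sda j m h]; abel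
  have Sma : ∀ j m, m < j → S j * (c m - star (c m)) = -((c m - star (c m)) * S j) := fun j m h => by
    rw [mul_sub, sub_mul, Sca j m h, Sda j m h]; abel
  have pp : ∀ l, (star (c l) + c l) * (star (c l) + c l) = 1 := fun l => by
    rw [mul_add, add_mul, add_mul, hc2, hd2, ← hdc l]; abel
  have mm : ∀ l, (c l - star (c l)) * (c l - star (c l)) = -1 := fun l => by
    rw [mul_sub, sub_mul, sub_mul, hc2, hd2, ← hdc l]; abel
  have pm : ∀ l, (star (c l) + c l) * (c l - star (c l)) = σz l := fun l => by
    rw [mul_sub, add_mul, add_mul, hc2, hd2, hcdc l, hσz, two_mul]; abel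
  have mp : ∀ l, (c l - star (c l)) * (star (c l) + c l) = -σz l := fun l => by
    rw [mul_add, sub_mul, sub_mul, hc2, hd2, hcdc l, hσz, two_mul]; abel
  have key : ∀ l u v, S l * u = u * S l → (S l * u) * (S l * v) = u * v := fun l u v h => by
    rw [h, mul_assoc, ← mul_assoc (S l), S1, one_mul]
  have II : ∀ x : A, Complex.I • Complex.I • x = -x := fun x => by
    rw [smul_smul, Complex.I_mul_I, neg_one_smul]
  refine ⟨fun l => ?_, ?_⟩
  · have P := Spc l l le_rfl
    have M := Smc l l le_rfl
    have exy : σx l * σy l = Complex.I • σz l := by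
      rw [hσx, hσy, mul_smul_comm, key _ _ _ P, pm]
    have eyx : σy l * σx l = -(Complex.I • σz l) := by
      rw [hσx, hσy, smul_mul_assoc, key _ _ _ M, mp, smul_neg]
    refine ⟨?_, ?_, ?_, ?_, zs l, ?_, exy, ?_⟩
    · rw [hσx, star_mul, Ss, star_add, star_star, P, add_comm]
    · rw [sq, hσx, key _ _ _ P, pp]
    · rw [hσy, star_smul, star_mul, Ss, star_sub, star_star, M, ← neg_sub (c l), neg_mul, smul_neg]
      simp
    · rw [sq, hσy, smul_mul_assoc, mul_smul_comm, II, key _ _ _ M, mm, neg_neg]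
    · rw [sq, zz1]
    · rw [exy, eyx, add_neg_cancel]
  · -- commutation at different sites
    have comm2 : ∀ l k u v, S l * v = v * S l → S k * u = -(u * S k) → u * v = -(v * u) →
        (S l * u) * (S k * v) = (S k * v) * (S l * u) := fun l k u v h1 h2 h3 => by
      have h2' : u * S k = -(S k * u) := by rw [h2, neg_neg]
      calc (S l * u) * (S k * v) = S l * (u * S k) * v := by simp only [mul_assoc]
        _ = -(S l * S k * (u * v)) := by rw [h2']; simp only [mul_assoc, mul_neg, neg_mul]
        _ = S k * (S l * v) * u := by rw [h3, SS]; simp only [mul_assoc, mul_neg, neg_neg]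
        _ = _ := by rw [h1]; simp only [mul_assoc]
    have commz : ∀ l k u, σz k * u = u * σz k → (S l * u) * σz k = σz k * (S l * u) :=
      fun l k u h => by rw [mul_assoc, ← h, ← mul_assoc, Sz, mul_assoc]
    have zp : ∀ l k, k ≠ l → σz k * (star (c l) + c l) = (star (c l) + c l) * σz k :=
      fun l k h => by rw [mul_add, add_mul, zd k l h, zc k l h]
    have zm : ∀ l k, k ≠ l → σz k * (c l - star (c l)) = (c l - star (c l)) * σz k :=
      fun l k h => by rw [mul_sub, sub_mul, zd k l h, zc k l h]
    have main : ∀ l k : ℤ, l < k →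
        ∀ a ∈ ({σx l, σy l, σz l} : Set A), ∀ b ∈ ({σx k, σy k, σz k} : Set A),
          a * b = b * a := by
      intro l k h
      have n1 : c l * c k = -(c k * c l) := eq_neg_of_add_eq_zero_left (hcc l k)
      have n2 : star (c l) * star (c k) = -(star (c k) * star (c l)) :=
        eq_neg_of_add_eq_zero_left (hcstar l k)
      have n3 : star (c l) * c k = -(c k * star (c l)) :=
        eq_neg_of_add_eq_zero_left (hdc' l k h.ne)
      have n4 : c l * star (c k) = -(star (c k) * c l) :=
        eq_neg_of_add_eq_zero_right (hdc' k l h.ne')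
      have P1 := Spc l k h.le
      have M1 := Smc l k h.le
      have P2 := Spa k l h
      have M2 := Sma k l h
      intro a ha b hb
      simp only [Set.mem_insert_iff, Set.mem_singleton_iff] at ha hb
      rcases ha with rfl | rfl | rfl <;> rcases hb with rfl | rfl | rfl
      · rw [hσx, hσx]
        refine comm2 _ _ _ _ P1 P2 ?_
        simp only [mul_add, add_mul, n1, n2, n3, n4]; abel
      · rw [hσx, hσy, mul_smul_comm, smul_mul_assoc]
        congr 1
        refine comm2 _ _ _ _ M1 P2 ?_
        simp only [mul_add, add_mul, mul_sub, sub_mul, n1, n2, n3, n4]; abel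
      · rw [hσx]; exact commz _ _ _ (zp l k h.ne')
      · rw [hσx, hσy, mul_smul_comm, smul_mul_assoc]
        congr 1
        refine comm2 _ _ _ _ P1 M2 ?_
        simp only [mul_add, add_mul, mul_sub, sub_mul, n1, n2, n3, n4]; abel
      · rw [hσy, hσy]
        simp only [mul_smul_comm, smul_mul_assoc]
        congr 2
        refine comm2 _ _ _ _ M1 M2 ?_
        simp only [mul_sub, sub_mul, n1, n2, n3, n4]; abel
      · rw [hσy, mul_smul_comm, smul_mul_assoc, commz _ _ _ (zm l k h.ne')]
      · rw [hσx]; exact (commz _ _ _ (zp k l h.ne)).symm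
      · rw [hσy, mul_smul_comm, smul_mul_assoc, commz _ _ _ (zm k l h.ne)]
      · exact zz l k
    intro l k hlk a ha b hb
    rcases lt_or_gt_of_ne hlk with h | h
    · exact main l k h a ha b hb
    · exact (main k l h b hb a ha).symm
end
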